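/- Let α₀, β₀, γ₀ ∈ ℝ and let a : ℝ → ℝ be continuously differentiable with a(u) > 0 for all u, satisfying the structural condition d/du( a(u)^{-1/2} ) = β₀·√(a(u)) − α₀·a(u) − γ₀ for all u. Let Ω ⊆ ℝ × ℝ be an open set on which α₀x + γ₀t ≠ 0, and let u : Ω → ℝ be twice continuously differentiable with u_t(x,t) = a(u(x,t))·u_x(x,t) − 1/( √(a(u(x,t)))·(α₀x + γ₀t) ) on Ω. Then u satisfies u_tt − a(u)²·u_xx = 2·a(u)·a'(u)·u_x² + β₀/(α₀x + γ₀t)² at every point of Ω. -/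

import Mathlib

/-- Partial derivative of `u(x,t)` with respect to the first argument `x`. -/
noncomputable def px (u : ℝ × ℝ → ℝ) (p : ℝ × ℝ) : ℝ := fderiv ℝ u p (1, 0)

/-- Partial derivative of `u(x,t)` with respect to the second argument `t`. -/
noncomputable def pt (u : ℝ × ℝ → ℝ) (p : ℝ × ℝ) : ℝ := fderiv ℝ u p (0, 1)

/-- The derivative of `a^{-1/2}` along a differentiable positive function `a`. -/
theorem hasDerivAt_inv_sqrt_comp {a : ℝ → ℝ} {a' v : ℝ} (ha : HasDerivAt a a' v)
    (hv : 0 < a v) :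
    HasDerivAt (fun w => (Real.sqrt (a w))⁻¹) (-(a' / (2 * Real.sqrt (a v))) / a v) v := by
  have h := (ha.sqrt hv.ne').fun_inv (Real.sqrt_pos.2 hv).ne'
  rwa [Real.sq_sqrt hv.le] at h

/-- Differentiating `fderiv ℝ u · w` in direction `v` gives the second derivative of `u`. -/
theorem fderiv_fderiv_apply {u : ℝ × ℝ → ℝ} {p : ℝ × ℝ}
    (hu : DifferentiableAt ℝ (fderiv ℝ u) p) (v w : ℝ × ℝ) :
    fderiv ℝ (fun q => fderiv ℝ u q w) p v = fderiv ℝ (fderiv ℝ u) p v w := by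
  rw [fderiv_clm_apply hu (differentiableAt_const w)]
  simp

/-- The mixed partial derivatives of a `C²` function agree. -/
theorem pt_px_eq_px_pt {u : ℝ × ℝ → ℝ} {p : ℝ × ℝ} (hu : ContDiffAt ℝ 2 u p) :
    pt (px u) p = px (pt u) p := by
  have hD : DifferentiableAt ℝ (fderiv ℝ u) p :=
    (hu.fderiv_right (m := 1) (by norm_num)).differentiableAt one_ne_zero
  have hsymm : IsSymmSndFDerivAt ℝ u p := hu.isSymmSndFDerivAt (by simp)
  exact (fderiv_fderiv_apply hD (0, 1) (1, 0)).trans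
    ((hsymm.eq (0, 1) (1, 0)).trans (fderiv_fderiv_apply hD (1, 0) (0, 1)).symm)

/-- If `a > 0` satisfies `d/du(a^{-1/2}) = β₀√a − α₀a − γ₀` and, on an open set `Ω` where
`α₀x + γ₀t ≠ 0`, `u` satisfies `u_t = a(u)·u_x − 1/(√(a(u))·(α₀x + γ₀t))`, then on `Ω`
`u_tt − a(u)²·u_xx = 2·a(u)·a'(u)·u_x² + β₀/(α₀x + γ₀t)²`. -/
theorem structural_case_intermediate_integral
    (α₀ β₀ γ₀ : ℝ) (a : ℝ → ℝ)
    (ha : ContDiff ℝ 1 a) (hapos : ∀ v : ℝ, 0 < a v)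
    (hstruct : ∀ v : ℝ,
      deriv (fun w => (Real.sqrt (a w))⁻¹) v = β₀ * Real.sqrt (a v) - α₀ * a v - γ₀)
    (Ω : Set (ℝ × ℝ)) (hΩ : IsOpen Ω)
    (hne : ∀ p ∈ Ω, α₀ * p.1 + γ₀ * p.2 ≠ 0)
    (u : ℝ × ℝ → ℝ) (hu : ContDiffOn ℝ 2 u Ω)
    (heq : ∀ p ∈ Ω, pt u p =
      a (u p) * px u p - 1 / (Real.sqrt (a (u p)) * (α₀ * p.1 + γ₀ * p.2))) :
    ∀ p ∈ Ω,
      pt (pt u) p - (a (u p))^2 * px (px u) p =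
        2 * a (u p) * deriv a (u p) * (px u p)^2
          + β₀ / (α₀ * p.1 + γ₀ * p.2)^2 := by
  intro p hp
  have hup : ContDiffAt ℝ 2 u p := hu.contDiffAt (hΩ.mem_nhds hp)
  have hmixed := pt_px_eq_px_pt hup
  have hL := hne p hp
  have hpos := hapos (u p)
  have hD : DifferentiableAt ℝ (fderiv ℝ u) p :=
    (hup.fderiv_right (m := 1) (by norm_num)).differentiableAt one_ne_zero
  have hux : HasFDerivAt (px u) (fderiv ℝ (px u) p) p :=
    (hD.clm_apply (differentiableAt_const _)).hasFDerivAt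
  have hud : HasFDerivAt u (fderiv ℝ u p) p :=
    (hup.differentiableAt two_ne_zero).hasFDerivAt
  have had : HasDerivAt a (deriv a (u p)) (u p) :=
    (ha.differentiable one_ne_zero _).hasDerivAt
  have hb := hasDerivAt_inv_sqrt_comp had hpos
  have hs := hstruct (u p)
  rw [hb.deriv] at hs
  have hl : HasFDerivAt (fun q : ℝ × ℝ => α₀ * q.1 + γ₀ * q.2)
      (α₀ • ContinuousLinearMap.fst ℝ ℝ ℝ + γ₀ • ContinuousLinearMap.snd ℝ ℝ ℝ) p :=
    (hasFDerivAt_fst.const_mul α₀).add (hasFDerivAt_snd.const_mul γ₀)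
  have hrhs := ((had.comp_hasFDerivAt p hud).mul hux).sub
    ((hb.comp_hasFDerivAt p hud).mul ((hasDerivAt_inv hL).comp_hasFDerivAt p hl))
  have hut := hrhs.congr_of_eventuallyEq (f₁ := pt u) (by
    filter_upwards [hΩ.mem_nhds hp] with q hq
    rw [heq q hq]
    simp [mul_comm])
  have htt : pt (pt u) p = _ := congrArg (fun T => T (0, 1)) hut.fderiv
  have htx : px (pt u) p = _ := congrArg (fun T => T (1, 0)) hut.fderiv
  have e₁ : fderiv ℝ u p (1, 0) = px u p := rfl
  have e₂ : fderiv ℝ u p (0, 1) = pt u p := rfl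
  have e₃ : fderiv ℝ (px u) p (1, 0) = px (px u) p := rfl
  have e₄ : fderiv ℝ (px u) p (0, 1) = pt (px u) p := rfl
  simp only [Function.comp_apply, smul_add, neg_smul, smul_neg, sub_apply, add_apply,
    smul_apply, e₄, smul_eq_mul, e₂, neg_apply, ContinuousLinearMap.coe_fst', mul_zero,
    neg_zero, ContinuousLinearMap.coe_snd', mul_one, zero_add, e₃, e₁, add_zero] at htt htx
  rw [htt, hmixed, htx, heq p hp]
  have hsq : a (u p) = Real.sqrt (a (u p)) ^ 2 := (Real.sq_sqrt hpos.le).symm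
  have hspos := Real.sqrt_pos.2 hpos
  generalize α₀ * p.1 + γ₀ * p.2 = L at hL ⊢
  generalize deriv a (u p) = d at hs ⊢
  generalize Real.sqrt (a (u p)) = s at hs hsq hspos ⊢
  rw [hsq] at hs ⊢
  obtain rfl : γ₀ = β₀ * s - α₀ * s ^ 2 + d / (2 * s) / s ^ 2 := by linear_combination hs
  field_simp
  ring
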